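/- arXiv:2407.02884 — 2 statements merged into one kernel-verified Lean document; each statement's English description precedes it below -/
import Mathlib

section
/- SRT are closed under Kleene-star: for every SRT T over U there exists an SRT T_* over U such that for every string S over U and every match M, M ∈ Match(T_*,S) iff there exist n ≥ 1, a decomposition S = S₁·S₂⋯S_n into nonempty substrings, and matches M_i ∈ Match(T,S_i) for 1 ≤ i ≤ n — where the positions in each Match(T,S_i) are shifted so as to refer to absolute positions in S — such that M = M₁·M₂⋯M_n. -/
open scoped Classical

/-- A valuation over registers `R` with data elements from `U`:
a partial function from registers to data elements. -/
abbrev Val (U R : Type*) := R → Option U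

/-- The everywhere-undefined valuation `♯`. -/
def Val.sharp {U R : Type*} : Val U R := fun _ => none

/-- `v.updateW W u` updates every register in `W` to hold `u`. -/
noncomputable def Val.updateW {U R : Type*} (v : Val U R) (W : Set R) (u : U) :
    Val U R := fun r => if r ∈ W then some u else v r

/-- A condition over `(U, R)`: an arbitrary predicate on pairs of a data
element and a valuation. -/
abbrev Cond (U R : Type*) := U → Val U R → Prop

/-- `MatchCat M₁ M₂ M` states that `M = M₁ · M₂`: `M₁` and `M₂` are disjoint,
`M` is their union, and every position of `M₁` is smaller than every position
of `M₂`. -/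
def MatchCat (M₁ M₂ M : Finset ℕ) : Prop :=
  Disjoint M₁ M₂ ∧ M = M₁ ∪ M₂ ∧ ∀ i ∈ M₁, ∀ j ∈ M₂, i < j

/-- Symbolic regular expressions with memory and output over `(U, R)`.
The output `true` stands for `•` and `false` for `⊗`. -/
inductive SREMO (U R : Type*) where
  | empty : SREMO U R
  | eps : SREMO U R
  | cond (φ : Cond U R) (o : Bool) : SREMO U R
  | condW (φ : Cond U R) (o : Bool) (r : R) : SREMO U R
  | plus (e₁ e₂ : SREMO U R) : SREMO U R
  | cat (e₁ e₂ : SREMO U R) : SREMO U R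
  | star (e : SREMO U R) : SREMO U R

/-- The relation `(e, S, M, v) ⊢ v'`, where the `ℕ` argument is the absolute
position (1-based) in the ambient string of the first element of the slice `S`;
positions recorded in `M` are absolute positions. -/
inductive SREMO.Derives {U R : Type*} :
    SREMO U R → ℕ → List U → Finset ℕ → Val U R → Val U R → Prop
  | eps (off : ℕ) (v : Val U R) : Derives .eps off [] ∅ v v
  | cond {φ : Cond U R} {o : Bool} (off : ℕ) {u : U} {v : Val U R} :
      φ u v → Derives (.cond φ o) off [u] (if o then {off} else ∅) v v
  | condW {φ : Cond U R} {o : Bool} {r : R} (off : ℕ) {u : U} {v : Val U R} :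
      φ u v →
      Derives (.condW φ o r) off [u] (if o then {off} else ∅) v (v.updateW {r} u)
  | plusL {e₁ e₂ : SREMO U R} {off : ℕ} {S : List U} {M : Finset ℕ}
      {v v' : Val U R} :
      Derives e₁ off S M v v' → Derives (.plus e₁ e₂) off S M v v'
  | plusR {e₁ e₂ : SREMO U R} {off : ℕ} {S : List U} {M : Finset ℕ}
      {v v' : Val U R} :
      Derives e₂ off S M v v' → Derives (.plus e₁ e₂) off S M v v'
  | cat {e₁ e₂ : SREMO U R} {off : ℕ} {S₁ S₂ : List U} {M₁ M₂ M : Finset ℕ}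
      {v v'' v' : Val U R} :
      MatchCat M₁ M₂ M → Derives e₁ off S₁ M₁ v v'' →
      Derives e₂ (off + S₁.length) S₂ M₂ v'' v' →
      Derives (.cat e₁ e₂) off (S₁ ++ S₂) M v v'
  | starNil {e : SREMO U R} (off : ℕ) (v : Val U R) :
      Derives (.star e) off [] ∅ v v
  | starCons {e : SREMO U R} {off : ℕ} {S₁ S₂ : List U} {M₁ M₂ M : Finset ℕ}
      {v v'' v' : Val U R} :
      S₁ ≠ [] → MatchCat M₁ M₂ M → Derives e off S₁ M₁ v v'' →
      Derives (.star e) (off + S₁.length) S₂ M₂ v'' v' →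
      Derives (.star e) off (S₁ ++ S₂) M v v'

/-- `Lang(e)`: the strings derivable from `e` starting with all registers empty. -/
def SREMO.Lang {U R : Type*} (e : SREMO U R) : Set (List U) :=
  {S | ∃ (M : Finset ℕ) (v' : Val U R), e.Derives 1 S M Val.sharp v'}

/-- `Match(e, S)`: the matches of `e` on the string `S`. -/
def SREMO.Matches {U R : Type*} (e : SREMO U R) (S : List U) : Set (Finset ℕ) :=
  {M | ∃ v' : Val U R, e.Derives 1 S M Val.sharp v'}

/-- The window constraint: whenever `M ≠ ∅`, `max M - min M + 1 ≤ w`. -/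
def WindowOK (M : Finset ℕ) (w : ℕ) : Prop :=
  ∀ h : M.Nonempty, M.max' h - M.min' h + 1 ≤ w

/-- `Lang(e^[1..w])`: the language of the windowed SREMO `e^[1..w]`. -/
def SREMO.WLang {U R : Type*} (e : SREMO U R) (w : ℕ) : Set (List U) :=
  {S | ∃ (M : Finset ℕ) (v' : Val U R),
    e.Derives 1 S M Val.sharp v' ∧ WindowOK M w}

/-- A transition of a symbolic register transducer: source, condition
(`none` denotes `ε`), write registers, target, output (`true` is `•`). -/
structure SRTTransition (U State Reg : Type*) where
  src : State
  cond : Option (Cond U Reg)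
  wr : Set Reg
  tgt : State
  out : Bool

/-- A symbolic register transducer over `U`. -/
structure SRT (U : Type*) where
  State : Type
  Reg : Type
  stateFinite : Finite State
  regFinite : Finite Reg
  start : State
  final : Set State
  trans : Set (SRTTransition U State Reg)
  transFinite : trans.Finite

/-- A configuration: position, current state, current valuation. -/
structure SRTConfig (U State Reg : Type*) where
  pos : ℕ
  state : State
  val : Val U Reg

/-- `c'` is a successor of `c` via the transition `δ`, while reading `S`. -/
def SRT.Step {U : Type*} (T : SRT U) (S : List U)
    (δ : SRTTransition U T.State T.Reg)
    (c c' : SRTConfig U T.State T.Reg) : Prop :=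
  δ ∈ T.trans ∧ δ.src = c.state ∧ δ.tgt = c'.state ∧
    ((δ.cond = none ∧ c'.pos = c.pos ∧ c'.val = c.val) ∨
      (∃ (φ : Cond U T.Reg) (u : U), δ.cond = some φ ∧
        S[c.pos - 1]? = some u ∧ φ u c.val ∧
        c'.pos = c.pos + 1 ∧ c'.val = c.val.updateW δ.wr u))

/-- The positions marked when a transition `δ` is taken at position `j`:
`{j}` if `δ` is a non-ε transition with output `•`, and `∅` otherwise. -/
def SRTTransition.mark {U State Reg : Type*} (δ : SRTTransition U State Reg)
    (j : ℕ) : Finset ℕ :=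
  match δ.cond, δ.out with
  | some _, true => {j}
  | _, _ => ∅

/-- A run of `T` over `S` from configuration `c` to configuration `c'`,
via the list of transitions `δs`, producing the match `M`. -/
inductive SRT.Run {U : Type*} (T : SRT U) (S : List U) :
    SRTConfig U T.State T.Reg → List (SRTTransition U T.State T.Reg) →
      Finset ℕ → SRTConfig U T.State T.Reg → Prop
  | nil (c : SRTConfig U T.State T.Reg) : Run T S c [] ∅ c
  | cons {c c' c'' : SRTConfig U T.State T.Reg}
      {δ : SRTTransition U T.State T.Reg}
      {δs : List (SRTTransition U T.State T.Reg)} {M : Finset ℕ} :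
      T.Step S δ c c' → Run T S c' δs M c'' →
      Run T S c (δ :: δs) (δ.mark c.pos ∪ M) c''

/-- The initial configuration `[1, q_s, ♯]`. -/
def SRT.init {U : Type*} (T : SRT U) : SRTConfig U T.State T.Reg :=
  ⟨1, T.start, Val.sharp⟩

/-- `T` has an accepting run over `S` with match `M`: a run starting at
`[1, q_s, ♯]`, ending at position `|S| + 1` in a final state, whose last
transition has output `•`. -/
def SRT.AccMatch {U : Type*} (T : SRT U) (S : List U) (M : Finset ℕ) : Prop :=
  ∃ (δs : List (SRTTransition U T.State T.Reg)) (q : T.State)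
    (v : Val U T.Reg) (δlast : SRTTransition U T.State T.Reg),
    T.Run S T.init δs M ⟨S.length + 1, q, v⟩ ∧ q ∈ T.final ∧
      δs.getLast? = some δlast ∧ δlast.out = true

/-- `Match(T, S)`: the matches of the accepting runs of `T` over `S`. -/
def SRT.MatchSet {U : Type*} (T : SRT U) (S : List U) : Set (Finset ℕ) :=
  {M | T.AccMatch S M}

/-- `Lang(T)`: the strings over which `T` has an accepting run. -/
def SRT.Lang {U : Type*} (T : SRT U) : Set (List U) :=
  {S | ∃ M : Finset ℕ, T.AccMatch S M}

/-- `Lang_oa(T)`: the output-agnostic language of `T` (outputs ignored). -/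
def SRT.LangOA {U : Type*} (T : SRT U) : Set (List U) :=
  {S | ∃ (δs : List (SRTTransition U T.State T.Reg)) (M : Finset ℕ)
      (q : T.State) (v : Val U T.Reg),
      T.Run S T.init δs M ⟨S.length + 1, q, v⟩ ∧ q ∈ T.final}

/-- `T` has no ε-transitions. -/
def SRT.NoEps {U : Type*} (T : SRT U) : Prop :=
  ∀ δ ∈ T.trans, δ.cond ≠ none

/-- `T` is deterministic: it has no ε-transitions and, for every state, every
element and every valuation, at most one transition from that state has a
condition satisfied by them. -/
def SRT.Deterministic {U : Type*} (T : SRT U) : Prop :=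
  T.NoEps ∧
    ∀ δ₁ ∈ T.trans, ∀ δ₂ ∈ T.trans,
      ∀ (φ₁ φ₂ : Cond U T.Reg) (u : U) (v : Val U T.Reg),
        δ₁.src = δ₂.src → δ₁.cond = some φ₁ → δ₂.cond = some φ₂ →
          φ₁ u v → φ₂ u v → δ₁ = δ₂

/-- `T` is complete: for every state, element and valuation, at least one
transition from that state has a condition satisfied by them (together with
determinism this gives exactly one). -/
def SRT.Complete {U : Type*} (T : SRT U) : Prop :=
  ∀ (q : T.State) (u : U) (v : Val U T.Reg),
    ∃ δ ∈ T.trans, δ.src = q ∧ ∃ φ : Cond U T.Reg, δ.cond = some φ ∧ φ u v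

/-- Iterated match concatenation: `MatchCatList [M₁, …, Mₙ] M` states that
`M = M₁ · M₂ ⋯ Mₙ`. -/
inductive MatchCatList : List (Finset ℕ) → Finset ℕ → Prop
  | nil : MatchCatList [] ∅
  | cons {M₁ : Finset ℕ} {Ms : List (Finset ℕ)} {M' M : Finset ℕ} :
      MatchCatList Ms M' → MatchCat M₁ M' M → MatchCatList (M₁ :: Ms) M

/-- The restriction of a valuation to a set of registers. -/
noncomputable def Val.restrict {U R : Type*} (v : Val U R) (L : Set R) : Val U R :=
  fun r => if r ∈ L then v r else none

theorem Val.restrict_empty {U R : Type*} (v : Val U R) : v.restrict ∅ = Val.sharp := by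
  funext r; simp [Val.restrict, Val.sharp]

theorem Val.restrict_updateW {U R : Type*} (v : Val U R) (L W : Set R) (u : U) :
    (v.updateW W u).restrict (L ∪ W) = (v.restrict L).updateW W u := by
  funext r
  by_cases hW : r ∈ W <;> by_cases hL : r ∈ L <;> simp [Val.restrict, Val.updateW, hW, hL]

theorem SRTTransition.mem_mark {U State Reg : Type*} {δ : SRTTransition U State Reg} {i j : ℕ} :
    i ∈ δ.mark j ↔ i = j ∧ δ.cond ≠ none ∧ δ.out = true := by
  rcases δ with ⟨_, _ | φ, _, _, _ | _⟩ <;> simp [SRTTransition.mark]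

namespace SRT

variable {U : Type*}

theorem Step.pos_le {T : SRT U} {S : List U} {δ : SRTTransition U T.State T.Reg}
    {c c' : SRTConfig U T.State T.Reg} (h : T.Step S δ c c') : c.pos ≤ c'.pos := by
  rcases h with ⟨-, -, -, ⟨-, h, -⟩ | ⟨φ, u, -, -, -, h, -⟩⟩ <;> omega

theorem Run.pos_le {T : SRT U} {S : List U} {c c' : SRTConfig U T.State T.Reg}
    {δs : List (SRTTransition U T.State T.Reg)} {M : Finset ℕ} (h : T.Run S c δs M c') :
    c.pos ≤ c'.pos := by
  induction h with
  | nil => exact le_rfl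
  | cons hs _ ih => exact hs.pos_le.trans ih

/-- A run only marks positions it reads. -/
theorem Run.mem_bounds {T : SRT U} {S : List U} {c c' : SRTConfig U T.State T.Reg}
    {δs : List (SRTTransition U T.State T.Reg)} {M : Finset ℕ} (h : T.Run S c δs M c')
    {i : ℕ} (hi : i ∈ M) : c.pos ≤ i ∧ i < c'.pos := by
  induction h with
  | nil => simp at hi
  | cons hs hr ih =>
    have hle := hs.pos_le
    have hle' := hr.pos_le
    rcases Finset.mem_union.1 hi with hi | hi
    · obtain ⟨rfl, hc, -⟩ := SRTTransition.mem_mark.1 hi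
      rcases hs with ⟨-, -, -, ⟨h, -⟩ | ⟨φ, u, -, -, -, h, -⟩⟩
      · exact absurd h hc
      · omega
    · have := ih hi
      omega

theorem Run.eq_of_nil {T : SRT U} {S : List U} {c c' : SRTConfig U T.State T.Reg} {M : Finset ℕ}
    (h : T.Run S c [] M c') : c = c' := by
  cases h
  rfl

theorem Run.append {T : SRT U} {S : List U} {c c' c'' : SRTConfig U T.State T.Reg}
    {δs δs' : List (SRTTransition U T.State T.Reg)} {M M' : Finset ℕ}
    (h : T.Run S c δs M c') (hnext : T.Run S c' δs' M' c'') :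
    T.Run S c (δs ++ δs') (M ∪ M') c'' := by
  induction h with
  | nil => simpa using hnext
  | cons hs _ ih =>
    rw [Finset.union_assoc]
    exact Run.cons hs (ih hnext)

/-- States of the iterated transducer: a hub between blocks (`none`), or a state of `T` together
with the registers written since the current block began and a flag telling whether the block
has consumed an element. -/
abbrev StarState (T : SRT U) : Type := Option (T.State × Set T.Reg × Bool)

/-- The registers written after taking `δ`, if those of `L` were written before. -/
noncomputable def liveAfter {Q R : Type*} (δ : SRTTransition U Q R) (L : Set R) : Set R :=
  if δ.cond.isSome then L ∪ δ.wr else L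

/-- The ε-transition opening a new block. -/
def starOpen (T : SRT U) : SRTTransition U T.StarState T.Reg :=
  ⟨none, none, ∅, some (T.start, ∅, false), false⟩

/-- The transition `δ` of `T` performed inside a block, with target `s`. Its condition ignores
the registers that were not written in the current block. -/
noncomputable def starLift (T : SRT U) (δ : SRTTransition U T.State T.Reg) (L : Set T.Reg)
    (b : Bool) (s : T.StarState) : SRTTransition U T.StarState T.Reg :=
  ⟨some (δ.src, L, b), δ.cond.map fun φ u v => φ u (v.restrict L), δ.wr, s, δ.out⟩

/-- The lift of `δ` that stays in the current block. -/
noncomputable def starInner (T : SRT U) (δ : SRTTransition U T.State T.Reg) (L : Set T.Reg)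
    (b : Bool) : SRTTransition U T.StarState T.Reg :=
  T.starLift δ L b (some (δ.tgt, liveAfter δ L, b || δ.cond.isSome))

/-- The transducer iterating `T` over consecutive nonempty blocks. -/
noncomputable abbrev iterate (T : SRT U) : SRT U where
  State := T.StarState
  Reg := T.Reg
  stateFinite := by
    have := T.stateFinite
    have := T.regFinite
    infer_instance
  regFinite := T.regFinite
  start := none
  final := {none}
  trans := {T.starOpen} ∪
    ((fun x : SRTTransition U T.State T.Reg × Set T.Reg × Bool =>
      T.starInner x.1 x.2.1 x.2.2) '' (T.trans ×ˢ Set.univ) ∪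
    (fun x : SRTTransition U T.State T.Reg × Set T.Reg × Bool =>
      T.starLift x.1 x.2.1 x.2.2 none) ''
        {x | x ∈ T.trans ×ˢ Set.univ ∧ x.1.out = true ∧ x.1.tgt ∈ T.final ∧
          (x.2.2 || x.1.cond.isSome) = true})
  transFinite := by
    have := T.regFinite
    have hfin : (T.trans ×ˢ (Set.univ : Set (Set T.Reg × Bool))).Finite :=
      T.transFinite.prod Set.finite_univ
    exact (Set.finite_singleton _).union
      ((hfin.image _).union ((hfin.subset fun x hx => hx.1).image _))

theorem starOpen_mem (T : SRT U) : T.starOpen ∈ T.iterate.trans :=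
  Or.inl rfl

theorem starInner_mem (T : SRT U) {δ : SRTTransition U T.State T.Reg} (hδ : δ ∈ T.trans)
    (L : Set T.Reg) (b : Bool) : T.starInner δ L b ∈ T.iterate.trans :=
  Or.inr (Or.inl ⟨(δ, L, b), ⟨hδ, trivial⟩, rfl⟩)

theorem starClose_mem (T : SRT U) {δ : SRTTransition U T.State T.Reg} (hδ : δ ∈ T.trans)
    (L : Set T.Reg) {b : Bool} (ho : δ.out = true) (hf : δ.tgt ∈ T.final)
    (hb : (b || δ.cond.isSome) = true) : T.starLift δ L b none ∈ T.iterate.trans :=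
  Or.inr (Or.inr ⟨(δ, L, b), ⟨⟨hδ, trivial⟩, ho, hf, hb⟩, rfl⟩)

theorem mark_starLift (T : SRT U) (δ : SRTTransition U T.State T.Reg) (L : Set T.Reg)
    (b : Bool) (s : T.StarState) (k j : ℕ) :
    (T.starLift δ L b s).mark (k + j) = (δ.mark j).image (· + k) := by
  rcases δ with ⟨_, _ | φ, _, _, _ | _⟩ <;>
    simp [SRTTransition.mark, starLift, add_comm]

/-- A step of `T` on a block is a step of the iterated transducer on the ambient string. -/
theorem Step.lift {T : SRT U} {P S₁ S₂ : List U} {δ : SRTTransition U T.State T.Reg}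
    {c c' : SRTConfig U T.State T.Reg} (h : T.Step S₁ δ c c') (hp : 1 ≤ c.pos)
    {v : Val U T.Reg} {L : Set T.Reg} (hv : c.val = v.restrict L) :
    ∃ v' : Val U T.Reg, c'.val = v'.restrict (liveAfter δ L) ∧
      ∀ (b : Bool) (s : T.StarState), T.starLift δ L b s ∈ T.iterate.trans →
        T.iterate.Step (P ++ (S₁ ++ S₂)) (T.starLift δ L b s)
          ⟨P.length + c.pos, some (c.state, L, b), v⟩ ⟨P.length + c'.pos, s, v'⟩ := by
  obtain ⟨-, hsrc, -, ⟨hc, hpos, hval⟩ | ⟨φ, u, hc, hu, hφ, hpos, hval⟩⟩ := h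
  · refine ⟨v, by simp [liveAfter, hc, hval, hv], fun b s hm => ⟨hm, ?_, rfl, Or.inl ?_⟩⟩
    · simp [starLift, hsrc]
    · simp [starLift, hc, hpos]
  · refine ⟨v.updateW δ.wr u, ?_, fun b s hm => ⟨hm, ?_, rfl, Or.inr ?_⟩⟩
    · simp [liveAfter, hc, hval, hv, Val.restrict_updateW]
    · simp [starLift, hsrc]
    · refine ⟨fun u v => φ u (v.restrict L), u, by simp [starLift, hc], ?_,
        show φ u (v.restrict L) from hv ▸ hφ,
        by simp [hpos, add_assoc], rfl⟩
      have hlt := (List.getElem?_eq_some_iff.1 hu).1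
      rw [show P.length + c.pos - 1 = P.length + (c.pos - 1) by omega,
        List.getElem?_append_right (by omega), Nat.add_sub_cancel_left,
        List.getElem?_append_left hlt, hu]

/-- The valuation part of a step of the iterated transducer, seen from `T`. -/
theorem Step.of_lift {T : SRT U} {P S₁ S₂ : List U} {δ : SRTTransition U T.State T.Reg}
    {L : Set T.Reg} {b : Bool} {s : T.StarState}
    {c c' : SRTConfig U T.StarState T.Reg} (hδ : δ ∈ T.trans)
    (h : T.iterate.Step (P ++ (S₁ ++ S₂)) (T.starLift δ L b s) c c')
    (hp : P.length + 1 ≤ c.pos) (hend : c'.pos ≤ P.length + S₁.length + 1) :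
    T.Step S₁ δ ⟨c.pos - P.length, δ.src, c.val.restrict L⟩
      ⟨c'.pos - P.length, δ.tgt, c'.val.restrict (liveAfter δ L)⟩ := by
  obtain ⟨-, -, -, ⟨hc, hpos, hval⟩ | ⟨φ, u, hc, hu, hφ, hpos, hval⟩⟩ := h
  · have hc' : δ.cond = none := by simpa [starLift] using hc
    exact ⟨hδ, rfl, rfl, Or.inl ⟨hc', by simp [hpos], by simp [liveAfter, hc', hval]⟩⟩
  · obtain ⟨ψ, hψ, rfl⟩ : ∃ ψ, δ.cond = some ψ ∧ (fun u v => ψ u (v.restrict L)) = φ := by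
      simpa [starLift] using hc
    refine ⟨hδ, rfl, rfl, Or.inr ⟨ψ, u, hψ, ?_, hφ, by simp only; omega, ?_⟩⟩
    · rw [List.getElem?_append_right (by omega), List.getElem?_append_left (by omega)] at hu
      rw [← hu]
      simp only
      congr 1
      omega
    · simp only [hval, liveAfter, hψ, Option.isSome_some, if_true]
      exact Val.restrict_updateW _ _ _ _

theorem Step.flag_of_lift {T : SRT U} {S : List U} {δ : SRTTransition U T.State T.Reg}
    {L : Set T.Reg} {b : Bool} {s : T.StarState} {c c' : SRTConfig U T.StarState T.Reg} {k : ℕ}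
    (h : T.iterate.Step S (T.starLift δ L b s) c c') (hp : k + 1 ≤ c.pos)
    (hb : b = true ↔ k + 1 < c.pos) : (b || δ.cond.isSome) = true ↔ k + 1 < c'.pos := by
  obtain ⟨-, -, -, ⟨hc, hpos, -⟩ | ⟨φ, u, hc, -, -, hpos, -⟩⟩ := h
  · have hc' : δ.cond = none := by simpa [starLift] using hc
    simp [hc', hpos, hb]
  · obtain ⟨ψ, hψ, -⟩ : ∃ ψ, δ.cond = some ψ ∧ (fun u v => ψ u (v.restrict L)) = φ := by
      simpa [starLift] using hc
    simp only [hψ, Option.isSome_some, Bool.or_true, true_iff]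
    omega

/-- An accepting run of `T` on a nonempty block lifts to a run of the iterated transducer
ending in the hub. -/
theorem Run.lift {T : SRT U} {P S₁ S₂ : List U} {c c' : SRTConfig U T.State T.Reg}
    {δs : List (SRTTransition U T.State T.Reg)} {M : Finset ℕ} (h : T.Run S₁ c δs M c')
    (hp : 1 ≤ c.pos) {v : Val U T.Reg} {L : Set T.Reg} (hv : c.val = v.restrict L)
    {b : Bool} (hb : b = true ↔ 1 < c.pos) {δl : SRTTransition U T.State T.Reg}
    (hl : δs.getLast? = some δl) (ho : δl.out = true) (hf : c'.state ∈ T.final)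
    (hne : 1 < c'.pos) :
    ∃ (δs' : List (SRTTransition U T.StarState T.Reg)) (v' : Val U T.Reg),
      T.iterate.Run (P ++ (S₁ ++ S₂)) ⟨P.length + c.pos, some (c.state, L, b), v⟩ δs'
        (M.image (· + P.length)) ⟨P.length + c'.pos, none, v'⟩ := by
  induction h generalizing v L b with
  | nil => simp at hl
  | @cons c c₁ c' δ δs M hs hr ih =>
    obtain ⟨v₁, hv₁, hstep⟩ := hs.lift (P := P) (S₂ := S₂) hp hv
    have hflag : (b || δ.cond.isSome) = true ↔ 1 < c₁.pos := by
      obtain ⟨-, -, -, ⟨hc, hpos, -⟩ | ⟨φ, u, hc, -, -, hpos, -⟩⟩ := hs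
      · simp [hc, hpos, hb]
      · simp only [hc, Option.isSome_some, Bool.or_true, true_iff]
        omega
    rw [Finset.image_union]
    cases δs with
    | nil =>
      cases hr
      obtain rfl : δ = δl := by simpa using hl
      rw [← mark_starLift T δ L b none]
      exact ⟨_, v₁, Run.cons (hstep b none (T.starClose_mem hs.1 L ho
        (hs.2.2.1 ▸ hf) (hflag.2 hne))) (Run.nil _)⟩
    | cons δ' δs =>
      obtain ⟨δs', v', hrun⟩ := ih (hp.trans hs.pos_le) hv₁ hflag (by simpa using hl) hf hne
      rw [← mark_starLift T δ L b (some (δ.tgt, liveAfter δ L, b || δ.cond.isSome))]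
      rw [← hs.2.2.1] at hrun
      exact ⟨_, v', Run.cons (hstep b _ (T.starInner_mem hs.1 L b)) hrun⟩

/-- `Blocks T k Ss Ms`: every string of `Ss` is nonempty and the corresponding entry of `Ms` is a
match of `T` on it, shifted by `k` plus the total length of the preceding strings. -/
inductive Blocks (T : SRT U) : ℕ → List (List U) → List (Finset ℕ) → Prop
  | nil (k : ℕ) : Blocks T k [] []
  | cons {k : ℕ} {S₁ : List U} {Ss : List (List U)} {M₁ : Finset ℕ} {Ms : List (Finset ℕ)} :
      S₁ ≠ [] → M₁ ∈ T.MatchSet S₁ → Blocks T (k + S₁.length) Ss Ms →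
      Blocks T k (S₁ :: Ss) (M₁.image (· + k) :: Ms)

theorem blocks_iff (T : SRT U) (k : ℕ) (Ss : List (List U)) (Ms : List (Finset ℕ)) :
    T.Blocks k Ss Ms ↔ ∃ hlen : Ms.length = Ss.length, (∀ Si ∈ Ss, Si ≠ []) ∧
      ∀ (i : ℕ) (h : i < Ss.length), ∃ Mi ∈ T.MatchSet (Ss[i]'h),
        Ms[i]'(h.trans_eq hlen.symm) = Mi.image (· + (k + (Ss.take i).flatten.length)) := by
  constructor
  · intro h
    induction h with
    | nil => simp
    | cons hne hM _ ih =>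
      obtain ⟨hlen, hnil, hi⟩ := ih
      refine ⟨by simp [hlen], by simpa using ⟨hne, hnil⟩, fun i h => ?_⟩
      cases i with
      | zero => exact ⟨_, hM, by simp⟩
      | succ i =>
        obtain ⟨Mi, hMi, he⟩ := hi i (by simpa using h)
        exact ⟨Mi, hMi, by simpa [add_assoc] using he⟩
  · rintro ⟨hlen, hnil, hi⟩
    induction Ss generalizing k Ms with
    | nil =>
      obtain rfl : Ms = [] := by simpa using hlen
      exact Blocks.nil k
    | cons S₁ Ss ih =>
      cases Ms with
      | nil => simp at hlen
      | cons M₁ Ms =>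
        obtain ⟨M, hM, he⟩ := hi 0 (by simp)
        obtain rfl : M₁ = M.image (· + k) := by simpa using he
        refine Blocks.cons (hnil _ (by simp)) hM
          (ih _ _ (by simpa using hlen) (fun Si h => hnil Si (by simp [h])) fun i h => ?_)
        obtain ⟨Mi, hMi, he⟩ := hi (i + 1) (by simpa using h)
        exact ⟨Mi, hMi, by simpa [add_assoc] using he⟩

/-- A decomposition into blocks yields a run of the iterated transducer from hub to hub. -/
theorem Blocks.exists_run {T : SRT U} {k : ℕ} {Ss : List (List U)} {Ms : List (Finset ℕ)}
    (h : T.Blocks k Ss Ms) {M : Finset ℕ} (hM : MatchCatList Ms M) {P : List U}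
    (hP : P.length = k) (v : Val U T.Reg) :
    ∃ (δs : List (SRTTransition U T.StarState T.Reg)) (v' : Val U T.Reg),
      T.iterate.Run (P ++ Ss.flatten) ⟨P.length + 1, none, v⟩ δs M
        ⟨(P ++ Ss.flatten).length + 1, none, v'⟩ := by
  induction h generalizing M P v with
  | nil =>
    cases hM
    exact ⟨[], v, by simpa using Run.nil _⟩
  | @cons k S₁ Ss M₁ Ms hne hM₁ _ ih =>
    cases hM with
    | @cons _ _ M' _ hM' hcat =>
      subst hP
      obtain ⟨δs, q, w, δl, hrun, hf, hl, ho⟩ := hM₁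
      obtain ⟨δs₁, v₁, h₁⟩ := hrun.lift (P := P) (S₂ := Ss.flatten) (v := v) (L := ∅) (b := false)
        le_rfl (Val.restrict_empty v).symm (by simp [SRT.init]) hl ho hf
        (by simpa using List.length_pos_iff.2 hne)
      obtain ⟨δs₂, v₂, h₂⟩ := ih hM' (P := P ++ S₁) (by simp) v₁
      rw [hcat.2.1]
      have hopen : T.iterate.Step (P ++ (S₁ ++ Ss.flatten)) T.starOpen
          ⟨P.length + 1, none, v⟩ ⟨P.length + 1, some (T.start, ∅, false), v⟩ :=
        ⟨T.starOpen_mem, rfl, rfl, Or.inl ⟨rfl, rfl, rfl⟩⟩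
      have h₀ := Run.cons hopen h₁
      have hmark : T.starOpen.mark (P.length + 1) = ∅ := rfl
      rw [hmark, Finset.empty_union] at h₀
      rw [List.append_assoc, List.length_append (as := P) (bs := S₁), add_assoc] at h₂
      exact ⟨_, v₂, h₀.append h₂⟩

/-- A run of the iterated transducer reaching the hub ends with a transition with output `•`. -/
theorem Run.getLast_out {T : SRT U} {S : List U}
    {c c' : SRTConfig U T.iterate.State T.iterate.Reg}
    {δs : List (SRTTransition U T.iterate.State T.iterate.Reg)} {M : Finset ℕ}
    (h : T.iterate.Run S c δs M c') (hst : c'.state = none)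
    {δl : SRTTransition U T.iterate.State T.iterate.Reg} (hl : δs.getLast? = some δl) :
    δl.out = true := by
  induction h with
  | nil => simp at hl
  | @cons c c₁ c' δ δs M hs hr ih =>
    cases δs with
    | cons δ' δs => exact ih hst (by simpa using hl)
    | nil =>
      cases hr
      obtain rfl : δ = δl := by simpa using hl
      have htgt := hs.2.2.1.trans hst
      rcases hs.1 with rfl | ⟨x, -, rfl⟩ | ⟨x, ⟨-, ho, -⟩, rfl⟩
      · cases htgt
      · cases htgt
      · exact ho

/-- From the hub, the remaining string decomposes into blocks; from inside a block beginning
after `P`, the run first completes an accepting run of `T`. -/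
theorem Run.exists_blocks {T : SRT U} {S : List U} {c c' : SRTConfig U T.iterate.State T.iterate.Reg}
    {δs : List (SRTTransition U T.iterate.State T.iterate.Reg)} {M : Finset ℕ}
    (h : T.iterate.Run S c δs M c') (hpos : c'.pos = S.length + 1) (hst : c'.state = none) :
    (c.state = none → ∀ P R, S = P ++ R → c.pos = P.length + 1 →
      ∃ Ss Ms, R = Ss.flatten ∧ T.Blocks P.length Ss Ms ∧ MatchCatList Ms M ∧
        (δs ≠ [] → Ss ≠ [])) ∧
    (∀ q L b, c.state = some (q, L, b) → ∀ P R, S = P ++ R → P.length + 1 ≤ c.pos →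
      (b = true ↔ P.length + 1 < c.pos) →
      ∃ S₁ Ss Ms M₁ M₂ δs₁ q₁ v₁ δl, R = S₁ ++ Ss.flatten ∧ S₁ ≠ [] ∧
        T.Run S₁ ⟨c.pos - P.length, q, c.val.restrict L⟩ δs₁ M₁ ⟨S₁.length + 1, q₁, v₁⟩ ∧
        q₁ ∈ T.final ∧ δs₁.getLast? = some δl ∧ δl.out = true ∧
        T.Blocks (P.length + S₁.length) Ss Ms ∧ MatchCatList Ms M₂ ∧
        (∀ j ∈ M₂, P.length + S₁.length < j) ∧ M = M₁.image (· + P.length) ∪ M₂) := by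
  induction h with
  | nil c =>
    refine ⟨fun _ P R hS hp => ⟨[], [], ?_, .nil _, .nil, fun h => absurd rfl h⟩, fun q L b h => ?_⟩
    · have := congrArg List.length hS
      rw [List.length_append] at this
      simpa using List.length_eq_zero_iff.1 (show R.length = 0 by omega)
    · rw [hst] at h
      cases h
  | @cons c c₁ c' δ δs M hs hr ih =>
    obtain ⟨ihHub, ihIn⟩ := ih hpos hst
    have hend : c₁.pos ≤ S.length + 1 := hpos ▸ hr.pos_le
    rcases hs.1 with rfl | ⟨⟨δ, L', b'⟩, ⟨hδ, -⟩, rfl⟩ | ⟨⟨δ, L', b'⟩, ⟨⟨hδ, -⟩, ho, hf, hb'⟩, rfl⟩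
    · refine ⟨fun hc P R hS hp => ?_, fun q L b hc => ?_⟩
      · obtain ⟨-, -, htgt, ⟨-, hp₁, hv₁⟩ | ⟨φ, u, hφ, -⟩⟩ := hs
        · obtain ⟨S₁, Ss, Ms, M₁, M₂, δs₁, q₁, v₁, δl, hR, hne, hrun, hfin, hl, ho, hB, hMs, hlt,
            rfl⟩ := ihIn _ _ _ htgt.symm P R hS (by omega) (by simp; omega)
          have hinit : (⟨c₁.pos - P.length, T.start, c₁.val.restrict ∅⟩ :
              SRTConfig U T.State T.Reg) = T.init := by
            rw [Val.restrict_empty, hp₁, hp, Nat.add_sub_cancel_left]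
            rfl
          rw [hinit] at hrun
          refine ⟨S₁ :: Ss, M₁.image (· + P.length) :: Ms, by simpa using hR,
            .cons hne ⟨δs₁, q₁, v₁, δl, hrun, hfin, hl, ho⟩ hB, .cons hMs ?_, by simp⟩
          have hsep : ∀ i ∈ M₁.image (· + P.length), ∀ j ∈ M₂, i < j := by
            intro i hi j hj
            obtain ⟨i, hi', rfl⟩ := Finset.mem_image.1 hi
            have h₁ := (hrun.mem_bounds hi').2
            have h₂ := hlt j hj
            simp only at h₁ ⊢
            omega
          have hmark : T.starOpen.mark c.pos = ∅ := rfl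
          exact ⟨Finset.disjoint_left.2 fun i hi hj => lt_irrefl i (hsep i hi i hj),
            by rw [hmark, Finset.empty_union], hsep⟩
        · cases hφ
      · have := hs.2.1.trans hc
        cases this
    · refine ⟨fun hc => ?_, fun q L b hc P R hS hp hb => ?_⟩
      · have := hs.2.1.trans hc
        cases this
      · have hsrc := hs.2.1.trans hc
        obtain ⟨rfl, rfl, rfl⟩ : δ.src = q ∧ L' = L ∧ b' = b := by
          simpa [starInner, starLift] using hsrc
        have hflag := hs.flag_of_lift hp hb
        obtain ⟨S₁, Ss, Ms, M₁, M₂, δs₁, q₁, v₁, δl, hR, hne, hrun, hfin, hl, ho, hB, hMs, hlt,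
          rfl⟩ := ihIn _ _ _ hs.2.2.1.symm P R hS (hp.trans hs.pos_le) hflag
        have hle := hrun.pos_le
        subst hS hR
        have hT := Step.of_lift hδ hs hp (by simp only at hle; omega)
        refine ⟨S₁, Ss, Ms, _, M₂, _, q₁, v₁, δl, rfl, hne, .cons hT hrun, hfin, ?_, ho, hB, hMs,
          hlt, ?_⟩
        · simp [List.getLast?_cons, hl]
        · rw [Finset.image_union, ← mark_starLift T δ L' b'
            (some (δ.tgt, liveAfter δ L', b' || δ.cond.isSome)), ← Finset.union_assoc]
          simp only [starInner, Nat.add_sub_cancel' (show P.length ≤ c.pos by omega)]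
    · refine ⟨fun hc => ?_, fun q L b hc P R hS hp hb => ?_⟩
      · have := hs.2.1.trans hc
        cases this
      · have hsrc := hs.2.1.trans hc
        obtain ⟨rfl, rfl, rfl⟩ : δ.src = q ∧ L' = L ∧ b' = b := by
          simpa [starLift] using hsrc
        have hlong := (hs.flag_of_lift hp hb).1 hb'
        obtain ⟨S₁, S₂, rfl, hlen⟩ : ∃ S₁ S₂, R = S₁ ++ S₂ ∧
            S₁.length = c₁.pos - 1 - P.length := by
          refine ⟨_, _, (List.take_append_drop (c₁.pos - 1 - P.length) R).symm, ?_⟩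
          have := congrArg List.length hS
          rw [List.length_append] at this
          rw [List.length_take]
          omega
        obtain ⟨Ss, Ms, rfl, hB, hMs, -⟩ := ihHub hs.2.2.1.symm (P ++ S₁) S₂ (by simp [hS])
          (by rw [List.length_append]; omega)
        subst hS
        have hrun : T.Run S₁ ⟨c.pos - P.length, δ.src, c.val.restrict L'⟩ [δ]
            (δ.mark (c.pos - P.length) ∪ ∅)
            ⟨S₁.length + 1, δ.tgt, c₁.val.restrict (liveAfter δ L')⟩ := by
          rw [show S₁.length + 1 = c₁.pos - P.length by omega]
          exact .cons (Step.of_lift hδ hs hp (by omega)) (.nil _)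
        refine ⟨S₁, Ss, Ms, _, M, [δ], _, _, δ, rfl, ?_, hrun, hf, rfl, ho,
          by simpa using hB, hMs, fun j hj => ?_, ?_⟩
        · rintro rfl
          simp only [List.length_nil] at hlen
          omega
        · have := (hr.mem_bounds hj).1
          omega
        · rw [Finset.union_empty, ← mark_starLift T δ L' b' none]
          simp only [Nat.add_sub_cancel' (show P.length ≤ c.pos by omega)]

end SRT

/-- SRT are closed under Kleene-star: `M` is a match of `T⋆`
on `S` iff `S` decomposes into `n ≥ 1` nonempty substrings `S₁ ⋯ Sₙ`, each
`Mᵢ` is (the shift, to absolute positions of `S`, of) a match of `T` on `Sᵢ`,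
and `M = M₁ · M₂ ⋯ Mₙ`. -/
theorem srt_closed_star {U : Type*} [Nonempty U] (T : SRT U) :
    ∃ Tstar : SRT U, ∀ (S : List U) (M : Finset ℕ),
      M ∈ Tstar.MatchSet S ↔
        ∃ (Ss : List (List U)) (Ms : List (Finset ℕ))
          (hlen : Ms.length = Ss.length),
          Ss ≠ [] ∧ (∀ Si ∈ Ss, Si ≠ []) ∧ S = Ss.flatten ∧
          (∀ (i : ℕ) (h : i < Ss.length),
            ∃ Mi ∈ T.MatchSet (Ss[i]'h),
              Ms[i]'(by omega) = Mi.image (· + ((Ss.take i).flatten.length))) ∧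
          MatchCatList Ms M := by
  refine ⟨T.iterate, fun S M => ⟨?_, ?_⟩⟩
  · rintro ⟨δs, q, v, δl, hrun, rfl, hl, -⟩
    obtain ⟨Ss, Ms, hS, hB, hM, hne⟩ := (hrun.exists_blocks rfl rfl).1 rfl [] S rfl rfl
    obtain ⟨hlen, hnil, hi⟩ := (T.blocks_iff _ _ _).1 hB
    exact ⟨Ss, Ms, hlen, hne (by rintro rfl; simp at hl), hnil, hS,
      fun i h => by simpa using hi i h, hM⟩
  · rintro ⟨Ss, Ms, hlen, hne, hnil, rfl, hi, hM⟩
    obtain ⟨δs, v, hrun⟩ := ((T.blocks_iff 0 Ss Ms).2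
      ⟨hlen, hnil, fun i h => by simpa using hi i h⟩).exists_run hM (P := []) rfl Val.sharp
    cases hl : δs.getLast? with
    | some δl => exact ⟨δs, none, v, δl, hrun, rfl, hl, hrun.getLast_out rfl hl⟩
    | none =>
      obtain rfl := List.getLast?_eq_none_iff.1 hl
      obtain ⟨S₁, Ss, rfl⟩ := List.exists_cons_of_ne_nil hne
      have hpos := List.length_pos_iff.2 (hnil S₁ (by simp))
      have hlen' : 1 = ((S₁ :: Ss).flatten).length + 1 := congrArg SRTConfig.pos hrun.eq_of_nil
      rw [List.flatten_cons, List.length_append] at hlen'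
      omega
end

section
/- If U is infinite, then for every SRT T_c over U, Lang_oa(T_c) ≠ {S = t₁⋯tₙ over U : t_i ≠ t_j whenever i ≠ j}; that is, no SRT accepts exactly the strings over U whose elements are pairwise distinct. -/
open scoped Classical

/-- `T.Reads q v s q' v'`: `T` can move from state `q` with valuation `v` to state `q'` with
valuation `v'` while consuming exactly the string `s`. -/
inductive SRT.Reads {U : Type*} (T : SRT U) :
    T.State → Val U T.Reg → List U → T.State → Val U T.Reg → Prop
  | nil (q : T.State) (v : Val U T.Reg) : Reads T q v [] q v
  | eps {δ : SRTTransition U T.State T.Reg} {v : Val U T.Reg} {s : List U} {q' : T.State}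
      {v' : Val U T.Reg} :
      δ ∈ T.trans → δ.cond = none → Reads T δ.tgt v s q' v' → Reads T δ.src v s q' v'
  | cons {δ : SRTTransition U T.State T.Reg} {φ : Cond U T.Reg} {u : U} {v : Val U T.Reg}
      {s : List U} {q' : T.State} {v' : Val U T.Reg} :
      δ ∈ T.trans → δ.cond = some φ → φ u v → Reads T δ.tgt (v.updateW δ.wr u) s q' v' →
      Reads T δ.src v (u :: s) q' v'

theorem SRT.Reads.append {U : Type*} {T : SRT U} {q q' q'' : T.State} {v v' v'' : Val U T.Reg}
    {s t : List U} (h : T.Reads q v s q' v') (h' : T.Reads q' v' t q'' v'') :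
    T.Reads q v (s ++ t) q'' v'' := by
  induction h with
  | nil => exact h'
  | eps hδ hc _ ih => exact .eps hδ hc (ih h')
  | cons hδ hc hφ _ ih => exact .cons hδ hc hφ (ih h')

theorem SRT.Reads.split {U : Type*} {T : SRT U} {q q'' : T.State} {v v'' : Val U T.Reg}
    {w : List U} (h : T.Reads q v w q'' v'') :
    ∀ s t : List U, w = s ++ t →
      ∃ q' v', T.Reads q v s q' v' ∧ T.Reads q' v' t q'' v'' := by
  induction h with
  | nil q v =>
    intro s t hst
    obtain ⟨rfl, rfl⟩ := List.append_eq_nil_iff.1 hst.symm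
    exact ⟨q, v, .nil _ _, .nil _ _⟩
  | eps hδ hc _ ih =>
    intro s t hst
    obtain ⟨q', v', h₁, h₂⟩ := ih s t hst
    exact ⟨q', v', .eps hδ hc h₁, h₂⟩
  | @cons δ φ u v s₀ _ _ hδ hc hφ hr ih =>
    intro s t hst
    cases s with
    | nil =>
      rw [List.nil_append] at hst
      subst hst
      exact ⟨_, _, .nil _ _, .cons hδ hc hφ hr⟩
    | cons a s =>
      obtain rfl := List.head_eq_of_cons_eq hst
      obtain ⟨q', v', h₁, h₂⟩ := ih s t (List.tail_eq_of_cons_eq hst)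
      exact ⟨q', v', .cons hδ hc hφ h₁, h₂⟩

/-- The registers only ever hold elements of the consumed string or of the initial valuation. -/
theorem SRT.Reads.val_mem {U : Type*} {T : SRT U} {P : Set U} {q q' : T.State}
    {v v' : Val U T.Reg} {s : List U} (h : T.Reads q v s q' v') (hs : ∀ u ∈ s, u ∈ P)
    (hv : ∀ r u, v r = some u → u ∈ P) : ∀ r u, v' r = some u → u ∈ P := by
  induction h with
  | nil => exact hv
  | eps _ _ _ ih => exact ih hs hv
  | @cons δ φ a v s _ _ _ _ _ _ ih =>
    refine ih (fun u hu => hs u (List.mem_cons_of_mem _ hu)) fun r u hr => ?_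
    unfold Val.updateW at hr
    split_ifs at hr
    · exact Option.some.inj hr ▸ hs a List.mem_cons_self
    · exact hv r u hr

theorem SRT.Run.reads {U : Type*} {T : SRT U} {S : List U} {c c' : SRTConfig U T.State T.Reg}
    {δs : List (SRTTransition U T.State T.Reg)} {M : Finset ℕ} (h : T.Run S c δs M c')
    (hend : c'.pos = S.length + 1) :
    ∀ p s : List U, S = p ++ s → c.pos = p.length + 1 →
      T.Reads c.state c.val s c'.state c'.val := by
  induction h with
  | nil c =>
    intro p s hS hpos
    have hs : s = [] := by
      rw [hpos, hS, List.length_append] at hend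
      exact List.length_eq_zero_iff.1 (by omega)
    subst hs
    exact .nil _ _
  | cons hstep _ ih =>
    intro p s hS hpos
    obtain ⟨hδ, hsrc, htgt, ⟨hc, hp, hv⟩ | ⟨φ, u, hc, hu, hφ, hp, hv⟩⟩ := hstep
    · have hr := ih hend p s hS (hp.trans hpos)
      rw [← htgt, hv] at hr
      exact hsrc ▸ .eps hδ hc hr
    · rw [hpos, hS, Nat.add_sub_cancel, List.getElem?_append_right le_rfl, Nat.sub_self] at hu
      cases s with
      | nil => simp at hu
      | cons a s =>
        obtain rfl : a = u := by simpa using hu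
        have hr := ih hend (p ++ [a]) s (by simp [hS]) (by simp [hp, hpos])
        rw [← htgt, hv] at hr
        exact hsrc ▸ .cons hδ hc hφ hr

theorem SRT.Reads.exists_run {U : Type*} {T : SRT U} {q q' : T.State} {v v' : Val U T.Reg}
    {s : List U} (h : T.Reads q v s q' v') (p : List U) :
    ∃ δs M, T.Run (p ++ s) ⟨p.length + 1, q, v⟩ δs M ⟨(p ++ s).length + 1, q', v'⟩ := by
  induction h generalizing p with
  | nil q v => exact ⟨[], ∅, by simpa using SRT.Run.nil _⟩
  | @eps δ _ _ _ _ hδ hc _ ih =>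
    obtain ⟨δs, M, hr⟩ := ih p
    refine ⟨_, _, .cons (δ := δ) ?_ hr⟩
    exact ⟨hδ, rfl, rfl, .inl ⟨hc, rfl, rfl⟩⟩
  | @cons δ φ u v s _ _ hδ hc hφ _ ih =>
    obtain ⟨δs, M, hr⟩ := ih (p ++ [u])
    rw [List.append_assoc, List.singleton_append] at hr
    refine ⟨_, _, .cons (δ := δ) ?_ hr⟩
    exact ⟨hδ, rfl, rfl, .inr ⟨φ, u, hc, by simp, hφ, by simp, rfl⟩⟩

theorem SRT.mem_langOA_iff {U : Type*} {T : SRT U} {S : List U} :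
    S ∈ T.LangOA ↔ ∃ q ∈ T.final, ∃ v, T.Reads T.start Val.sharp S q v := by
  constructor
  · rintro ⟨δs, M, q, v, hr, hq⟩
    exact ⟨q, hq, v, hr.reads rfl [] S rfl rfl⟩
  · rintro ⟨q, hq, v, hr⟩
    obtain ⟨δs, M, h⟩ := hr.exists_run []
    exact ⟨δs, M, q, v, h, hq⟩

theorem exists_mul_succ_pow_lt_two_pow (a k : ℕ) : ∃ n : ℕ, a * (n + 1) ^ k < 2 ^ n := by
  have hlim := (tendsto_pow_const_div_const_pow_of_one_lt k (one_lt_two (α := ℝ))).comp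
    (Filter.tendsto_add_atTop_nat 1)
  have hpos : (0 : ℝ) < 1 / (2 * (a + 1)) := by positivity
  obtain ⟨n, hn⟩ := (hlim.eventually_lt_const hpos).exists
  refine ⟨n, ?_⟩
  simp only [Function.comp_apply] at hn
  rw [div_lt_div_iff₀ (by positivity) (by positivity), pow_succ (2 : ℝ) n] at hn
  have hk : (0 : ℝ) ≤ ((n + 1 : ℕ) : ℝ) ^ k := by positivity
  have : (a : ℝ) * ((n + 1 : ℕ) : ℝ) ^ k < 2 ^ n := by nlinarith
  exact_mod_cast this

/-- If `U` is infinite then no SRT over `U` accepts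
(output-agnostically) exactly the strings whose elements are pairwise
distinct. -/
theorem srt_cannot_accept_pairwise_distinct {U : Type*} [Infinite U]
    (Tc : SRT U) :
    Tc.LangOA ≠ {S : List U |
      ∀ (i j : ℕ) (hi : i < S.length) (hj : j < S.length),
        i ≠ j → S[i]'hi ≠ S[j]'hj} := by
  intro hL
  have hmem (S : List U) : S ∈ Tc.LangOA ↔ S.Nodup := by
    rw [hL, Set.mem_ofPred_eq, List.nodup_iff_injective_getElem]
    exact ⟨fun h i j hij => Fin.ext (by_contra fun hne => h i j i.2 j.2 hne hij),
      fun h i j hi hj hne hij => hne (congrArg Fin.val (@h ⟨i, hi⟩ ⟨j, hj⟩ hij))⟩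
  have := Tc.stateFinite
  have := Tc.regFinite
  have := Fintype.ofFinite Tc.State
  have := Fintype.ofFinite Tc.Reg
  obtain ⟨n, hn⟩ :=
    exists_mul_succ_pow_lt_two_pow (Fintype.card Tc.State) (Fintype.card Tc.Reg)
  let e : Fin n → U := fun i => Infinite.natEmbedding U i
  have he : Function.Injective e := (Infinite.natEmbedding U).injective.comp Fin.val_injective
  -- Split an accepting run over an enumeration of all `n` elements after the elements of `X`.
  have hsplit (X : Finset (Fin n)) : ∃ c : Tc.State × (Tc.Reg → Option (Fin n)),
      Tc.Reads Tc.start Val.sharp (X.toList.map e) c.1 (fun r => (c.2 r).map e) ∧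
      ∃ q ∈ Tc.final, ∃ v, Tc.Reads c.1 (fun r => (c.2 r).map e) (Xᶜ.toList.map e) q v := by
    have hnd : (X.toList.map e ++ Xᶜ.toList.map e).Nodup := by
      rw [← List.map_append]
      refine List.Nodup.map he (List.nodup_append'.2 ⟨X.nodup_toList, Xᶜ.nodup_toList, ?_⟩)
      intro i hi hi'
      simp_all
    obtain ⟨q, hq, v, hr⟩ := SRT.mem_langOA_iff.1 ((hmem _).2 hnd)
    obtain ⟨q', v', h₁, h₂⟩ := hr.split _ _ rfl
    have hv' := h₁.val_mem (P := Set.range e) (by simp) (by simp [Val.sharp])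
    have hw (r : Tc.Reg) : ∃ o : Option (Fin n), o.map e = v' r := by
      cases hr : v' r with
      | none => exact ⟨none, rfl⟩
      | some u =>
        obtain ⟨i, rfl⟩ := hv' r u hr
        exact ⟨some i, rfl⟩
    choose w hw using hw
    obtain rfl : (fun r => (w r).map e) = v' := funext hw
    exact ⟨(q', w), h₁, q, hq, v, h₂⟩
  choose c hc₁ hc₂ using hsplit
  have hsub (X Y : Finset (Fin n)) (hXY : c X = c Y) : X ⊆ Y := by
    intro i hi
    by_contra hiY
    obtain ⟨q, hq, v, hr⟩ := hc₂ Y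
    rw [← hXY] at hr
    have hnd := (hmem _).1 (SRT.mem_langOA_iff.2 ⟨q, hq, v, (hc₁ X).append hr⟩)
    exact (List.nodup_append'.1 hnd).2.2
      (List.mem_map_of_mem (f := e) (Finset.mem_toList.2 hi))
      (List.mem_map_of_mem (Finset.mem_toList.2 (Finset.mem_compl.2 hiY)))
  have hinj : Function.Injective c := fun X Y h => (hsub X Y h).antisymm (hsub Y X h.symm)
  have hcard := Fintype.card_le_of_injective c hinj
  simp only [Fintype.card_finset, Fintype.card_prod, Fintype.card_fun, Fintype.card_option,
    Fintype.card_fin] at hcard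
  exact hn.not_ge hcard
end
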